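/- For a fixed fractional exponent, the posterior median is an efficient centering: Let α_n = α ∈ (0,1] be fixed, V > 0, and suppose (i) the pushforward of the random probability measure μ_n^Y under x ↦ √(n α)(x − ψ̂_n) converges weakly in P₀-probability to N(0,V), and (ii) √n(ψ̂_n − ψ(η₀)) converges in distribution to N(0,V). Then the posterior median ψ̄_n = a_{n,1/2}^Y (the 1/2-quantile of μ_n^Y) satisfies √n(ψ̄_n − ψ̂_n) → 0 in P₀-probability; consequently, for every δ ∈ (0,1), the shift-and-rescale set 𝒥_n = ( √α (a_{n,δ/2}^Y − ψ̄_n) + ψ̄_n , √α (a_{n,1−δ/2}^Y − ψ̄_n) + ψ̄_n ] satisfies P₀( ψ(η₀) ∈ 𝒥_n ) → 1 − δ. -/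

import Mathlib

open MeasureTheory ProbabilityTheory Filter Set

/-- The bounded-Lipschitz distance between two (probability) measures on `ℝ`. -/
noncomputable def dBL (μ ν : Measure ℝ) : ℝ :=
  ⨆ f : {f : ℝ → ℝ // LipschitzWith 1 f ∧ ∀ x, |f x| ≤ 1},
    |∫ x, f.1 x ∂μ - ∫ x, f.1 x ∂ν|

/-- The `p`-quantile of a probability measure on `ℝ`: `inf {x : Q(−∞, x] ≥ p}`. -/
noncomputable def quantile (Q : Measure ℝ) (p : ℝ) : ℝ :=
  sInf {x : ℝ | p ≤ (Q (Set.Iic x)).toReal}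

lemma abs_integral_sub_le_dBL (μ ν : Measure ℝ) [IsFiniteMeasure μ] [IsFiniteMeasure ν]
    {f : ℝ → ℝ} (hf : LipschitzWith 1 f) (hb : ∀ x, |f x| ≤ 1) :
    |∫ x, f x ∂μ - ∫ x, f x ∂ν| ≤ dBL μ ν := by
  have hbdd : BddAbove (Set.range
      (fun g : {f : ℝ → ℝ // LipschitzWith 1 f ∧ ∀ x, |f x| ≤ 1} =>
        |∫ x, g.1 x ∂μ - ∫ x, g.1 x ∂ν|)) := by
    refine ⟨1 * μ.real univ + 1 * ν.real univ, ?_⟩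
    rintro _ ⟨g, rfl⟩
    have h1 := norm_integral_le_of_norm_le_const (μ := μ) (f := g.1) (C := 1)
      (Eventually.of_forall g.2.2)
    have h2 := norm_integral_le_of_norm_le_const (μ := ν) (f := g.1) (C := 1)
      (Eventually.of_forall g.2.2)
    exact (abs_sub _ _).trans (add_le_add h1 h2)
  exact le_ciSup hbdd ⟨f, hf, hb⟩

lemma one_le_dBL_zero (γ : Measure ℝ) [IsProbabilityMeasure γ] : 1 ≤ dBL 0 γ := by
  simpa using abs_integral_sub_le_dBL 0 γ (f := fun _ => 1)
    (LipschitzWith.const' 1) (by simp)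

/-- Distribution functions of `dBL`-close measures are close up to a shift of the argument. -/
lemma mul_Iic_le_mul_Iic_add_dBL (μ ν : Measure ℝ) [IsProbabilityMeasure μ]
    [IsProbabilityMeasure ν] (x : ℝ) {h : ℝ} (h0 : 0 < h) (h1 : h ≤ 1) :
    h * μ.real (Iic x) ≤ h * ν.real (Iic (x + h)) + dBL μ ν ∧
    h * ν.real (Iic x) ≤ h * μ.real (Iic (x + h)) + dBL μ ν := by
  set f : ℝ → ℝ := fun y => max 0 (min h (x + h - y)) with hf
  have hlip : LipschitzWith 1 f :=
    (LipschitzWith.of_dist_le_mul (K := 1) fun a b => by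
      rw [Real.dist_eq, Real.dist_eq, NNReal.coe_one, one_mul, abs_sub_comm a b]
      apply le_of_eq; congr 1; ring).const_min h |>.const_max 0
  have hbd : ∀ y, |f y| ≤ 1 := fun y => by
    rw [abs_of_nonneg (le_max_left _ _)]
    exact max_le zero_le_one ((min_le_left _ _).trans h1)
  have key : ∀ ρ : Measure ℝ, IsProbabilityMeasure ρ →
      h * ρ.real (Iic x) ≤ ∫ y, f y ∂ρ ∧ ∫ y, f y ∂ρ ≤ h * ρ.real (Iic (x + h)) := by
    intro ρ _
    have hint : Integrable f ρ :=
      Integrable.of_bound hlip.continuous.aestronglyMeasurable 1 (Eventually.of_forall hbd)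
    have hI : ∀ t, ∫ y, (Iic t).indicator (fun _ => h) y ∂ρ = h * ρ.real (Iic t) := fun t => by
      rw [integral_indicator_const _ measurableSet_Iic, smul_eq_mul, mul_comm]
    have hIi : ∀ t, Integrable ((Iic t).indicator (fun _ => h)) ρ := fun t =>
      (integrable_const h).indicator measurableSet_Iic
    rw [← hI, ← hI]
    refine ⟨integral_mono (hIi _) hint fun y => ?_, integral_mono hint (hIi _) fun y => ?_⟩
    · by_cases hy : y ≤ x
      · simp only [indicator, mem_Iic, hy, if_true, hf]
        exact le_max_of_le_right (le_min le_rfl (by linarith))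
      · simp [indicator, hy, hf]
    · by_cases hy : y ≤ x + h
      · simp only [indicator, mem_Iic, hy, if_true, hf]
        exact max_le h0.le (min_le_left _ _)
      · simp only [indicator, mem_Iic, hy, if_false, hf]
        exact max_le le_rfl ((min_le_right _ _).trans (by linarith))
  have hd := abs_le.1 (abs_integral_sub_le_dBL μ ν hlip hbd)
  have hμ := key μ inferInstance
  have hν := key ν inferInstance
  constructor <;> linarith [hd.1, hd.2, hμ.1, hμ.2, hν.1, hν.2]

lemma exists_dBL_imp_Iic_lt (γ : Measure ℝ) [IsProbabilityMeasure γ] (x : ℝ) {ε e : ℝ}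
    (hε : 0 < ε) (he : 0 < e) :
    ∃ η > 0, ∀ ν : Measure ℝ, IsProbabilityMeasure ν → dBL ν γ ≤ η →
      γ.real (Iic (x - ε)) - e < ν.real (Iic x) ∧
      ν.real (Iic x) < γ.real (Iic (x + ε)) + e := by
  have h0 : 0 < min ε 1 := lt_min hε one_pos
  refine ⟨min ε 1 * (e / 2), by positivity, fun ν _ hd => ?_⟩
  set h := min ε 1
  have hhε : h ≤ ε := min_le_left _ _
  have a1 := (mul_Iic_le_mul_Iic_add_dBL ν γ x h0 (min_le_right _ _)).1
  have a2 := (mul_Iic_le_mul_Iic_add_dBL ν γ (x - h) h0 (min_le_right _ _)).2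
  rw [sub_add_cancel] at a2
  have m1 : γ.real (Iic (x + h)) ≤ γ.real (Iic (x + ε)) :=
    measureReal_mono (Iic_subset_Iic.2 (by linarith))
  have m2 : γ.real (Iic (x - ε)) ≤ γ.real (Iic (x - h)) :=
    measureReal_mono (Iic_subset_Iic.2 (by linarith))
  have b1 : ν.real (Iic x) ≤ γ.real (Iic (x + h)) + e / 2 :=
    le_of_mul_le_mul_left (by linarith) h0
  have b2 : γ.real (Iic (x - h)) ≤ ν.real (Iic x) + e / 2 :=
    le_of_mul_le_mul_left (by linarith) h0
  constructor <;> linarith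

lemma exists_dBL_imp_abs_Iic_sub_lt (γ : Measure ℝ) [IsProbabilityMeasure γ]
    (hc : Continuous fun x => γ.real (Iic x)) (x : ℝ) {e : ℝ} (he : 0 < e) :
    ∃ η > 0, ∀ ν : Measure ℝ, IsProbabilityMeasure ν → dBL ν γ ≤ η →
      |ν.real (Iic x) - γ.real (Iic x)| < e := by
  obtain ⟨d, hd, hclose⟩ := Metric.continuous_iff.1 hc x (e / 2) (by positivity)
  obtain ⟨η, hη, H⟩ := exists_dBL_imp_Iic_lt γ x (half_pos hd) (half_pos he)
  refine ⟨η, hη, fun ν hν hdν => ?_⟩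
  obtain ⟨h1, h2⟩ := H ν hν hdν
  have c1 := hclose (x - d / 2) (by simp [abs_of_pos hd, hd])
  have c2 := hclose (x + d / 2) (by simp [abs_of_pos hd, hd])
  rw [Real.dist_eq, abs_lt] at c1 c2
  rw [abs_lt]
  constructor <;> linarith [c1.1, c1.2, c2.1, c2.2]

/-- If the law of `c (X - m)` is `dBL`-close to `γ`, then the rescaled quantiles of `X` are
close to those of `γ`. -/
lemma exists_dBL_imp_abs_quantile_sub_le (γ : Measure ℝ) [IsProbabilityMeasure γ]
    (hmono : StrictMono fun x => γ.real (Iic x)) (z : ℝ) {ε : ℝ} (hε : 0 < ε) :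
    ∃ η > 0, ∀ (μ : Measure ℝ) (m c : ℝ), IsProbabilityMeasure μ → 0 < c →
      dBL (μ.map fun x => c * (x - m)) γ ≤ η →
      |c * (quantile μ (γ.real (Iic z)) - m) - z| ≤ ε := by
  have hε2 := half_pos hε
  have s1 : γ.real (Iic z) < γ.real (Iic (z + ε / 2)) := hmono (by linarith)
  have s2 : γ.real (Iic (z - ε / 2)) < γ.real (Iic z) := hmono (by linarith)
  obtain ⟨η₁, h₁, H₁⟩ := exists_dBL_imp_Iic_lt γ (z + ε) hε2 (sub_pos.2 s1)
  obtain ⟨η₂, h₂, H₂⟩ := exists_dBL_imp_Iic_lt γ (z - ε) hε2 (sub_pos.2 s2)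
  refine ⟨min η₁ η₂, lt_min h₁ h₂, fun μ m c _ hc hd => ?_⟩
  have hmeas : Measurable fun x : ℝ => c * (x - m) := by fun_prop
  have : IsProbabilityMeasure (μ.map fun x => c * (x - m)) :=
    Measure.isProbabilityMeasure_map hmeas.aemeasurable
  have b1 := (H₁ _ this (hd.trans (min_le_left _ _))).1
  have b2 := (H₂ _ this (hd.trans (min_le_right _ _))).2
  have hmap : ∀ t, (μ.map fun x => c * (x - m)).real (Iic t) = μ.real (Iic (t / c + m)) := by
    intro t
    rw [map_measureReal_apply hmeas measurableSet_Iic]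
    congr 1
    ext x
    rw [mem_preimage, mem_Iic, mem_Iic, ← sub_le_iff_le_add, le_div_iff₀ hc, mul_comm]
  rw [hmap] at b1 b2
  have e1 : z + ε - ε / 2 = z + ε / 2 := by ring
  have e2 : z - ε + ε / 2 = z - ε / 2 := by ring
  rw [e1] at b1
  rw [e2] at b2
  have hlow : ∀ x ∈ {x : ℝ | γ.real (Iic z) ≤ (μ (Iic x)).toReal}, (z - ε) / c + m ≤ x := by
    intro x hx
    by_contra! hlt
    have : μ.real (Iic x) ≤ μ.real (Iic ((z - ε) / c + m)) :=
      measureReal_mono (Iic_subset_Iic.2 hlt.le)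
    have hx' : γ.real (Iic z) ≤ μ.real (Iic x) := hx
    linarith
  have hmem : (z + ε) / c + m ∈ {x : ℝ | γ.real (Iic z) ≤ (μ (Iic x)).toReal} := by
    change γ.real (Iic z) ≤ μ.real _
    linarith
  have q1 : quantile μ (γ.real (Iic z)) ≤ (z + ε) / c + m := csInf_le ⟨_, hlow⟩ hmem
  have q2 : (z - ε) / c + m ≤ quantile μ (γ.real (Iic z)) := le_csInf ⟨_, hmem⟩ hlow
  have r1 := (le_div_iff₀ hc).1 (sub_le_iff_le_add.2 q1)
  have r2 := (div_le_iff₀ hc).1 (le_sub_iff_add_le.2 q2)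
  rw [abs_le]
  constructor <;> linarith

lemma continuous_measureReal_Iic (γ : Measure ℝ) [IsProbabilityMeasure γ] [NullSingletonClass γ] :
    Continuous fun x => γ.real (Iic x) := by
  have h : (fun x => γ.real (Iic x)) = cdf γ := funext fun x => (cdf_eq_real γ x).symm
  rw [h, continuous_iff_continuousAt]
  intro x
  rw [(cdf γ).mono.continuousAt_iff_leftLim_eq_rightLim, (cdf γ).rightLim_eq]
  have hs := (cdf γ).measure_singleton x
  rw [measure_cdf, measure_singleton, eq_comm, ENNReal.ofReal_eq_zero] at hs
  exact le_antisymm ((cdf γ).mono.leftLim_le le_rfl) (by linarith)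

lemma strictMono_gaussianReal_Iic (m : ℝ) {v : NNReal} (hv : v ≠ 0) :
    StrictMono fun x => (gaussianReal m v).real (Iic x) := by
  intro a b hab
  have hpos : 0 < (gaussianReal m v).real (Ioc a b) := by
    rw [measureReal_def, ENNReal.toReal_pos_iff]
    refine ⟨pos_iff_ne_zero.2 fun h0 => ?_, measure_lt_top _ _⟩
    have := gaussianReal_absolutelyContinuous' m hv h0
    simp [Real.volume_Ioc] at this
    linarith
  have := measureReal_union (μ := gaussianReal m v) (Iic_disjoint_Ioc (le_refl a) (c := b))
    measurableSet_Ioc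
  rw [Iic_union_Ioc_eq_Iic hab.le] at this
  simp only
  linarith

lemma gaussianReal_Iic_neg {v : NNReal} (hv : v ≠ 0) (x : ℝ) :
    (gaussianReal 0 v).real (Iic (-x)) = 1 - (gaussianReal 0 v).real (Iic x) := by
  have := nullSingletonClass_gaussianReal (μ := 0) hv
  have h1 : (gaussianReal 0 v).real (Iic (-x)) = (gaussianReal 0 v).real (Ici x) := by
    conv_lhs => rw [← neg_zero, ← gaussianReal_map_neg]
    rw [map_measureReal_apply measurable_neg measurableSet_Iic]
    congr 1
    ext y
    simp
  rw [h1, ← measureReal_congr (Ioi_ae_eq_Ici (a := x)), ← compl_Iic,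
    probReal_compl_eq_one_sub measurableSet_Iic]

lemma exists_measureReal_Iic_eq (γ : Measure ℝ) [IsProbabilityMeasure γ] [NullSingletonClass γ] {p : ℝ}
    (hp : p ∈ Ioo (0 : ℝ) 1) : ∃ z, γ.real (Iic z) = p := by
  have hbot := tendsto_cdf_atBot γ
  have htop := tendsto_cdf_atTop γ
  rw [show ⇑(cdf γ) = fun x => γ.real (Iic x) from funext (cdf_eq_real γ)] at hbot htop
  obtain ⟨a, ha⟩ := (hbot.eventually_lt_const hp.1).exists
  obtain ⟨b, hb⟩ := (htop.eventually_const_lt hp.2).exists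
  exact mem_range_of_exists_le_of_exists_ge (continuous_measureReal_Iic γ)
    ⟨a, ha.le⟩ ⟨b, hb.le⟩

lemma measureReal_map_Ioc {Ω : Type*} [MeasurableSpace Ω] (P : Measure Ω)
    [IsProbabilityMeasure P] {T : Ω → ℝ} (hT : AEMeasurable T P) {a b : ℝ} (hab : a ≤ b) :
    P.real {ω | T ω ∈ Ioc a b} = (P.map T).real (Iic b) - (P.map T).real (Iic a) := by
  have := Measure.isProbabilityMeasure_map hT
  have h := measureReal_union (μ := P.map T) (Iic_disjoint_Ioc (le_refl a) (c := b))
    measurableSet_Ioc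
  rw [Iic_union_Ioc_eq_Iic hab] at h
  have h2 : P.real {ω | T ω ∈ Ioc a b} = (P.map T).real (Ioc a b) := by
    rw [measureReal_def, measureReal_def, Measure.map_apply_of_aemeasurable hT measurableSet_Ioc]
    rfl
  linarith

lemma measureReal_le_map_Iic_sub_add {Ω : Type*} [MeasurableSpace Ω] (P : Measure Ω)
    [IsProbabilityMeasure P] {T : Ω → ℝ} (hT : AEMeasurable T P) {a b : ℝ} (hab : a ≤ b)
    {S B : Set Ω} (h : S ⊆ {ω | T ω ∈ Ioc a b} ∪ B) :
    P.real S ≤ (P.map T).real (Iic b) - (P.map T).real (Iic a) + P.real B := by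
  rw [← measureReal_map_Ioc P hT hab]
  exact (measureReal_mono h).trans (measureReal_union_le _ _)

lemma map_Iic_sub_le_measureReal_add {Ω : Type*} [MeasurableSpace Ω] (P : Measure Ω)
    [IsProbabilityMeasure P] {T : Ω → ℝ} (hT : AEMeasurable T P) {a b : ℝ}
    {S B : Set Ω} (h : {ω | T ω ∈ Ioc a b} ⊆ S ∪ B) :
    (P.map T).real (Iic b) - (P.map T).real (Iic a) ≤ P.real S + P.real B := by
  have := Measure.isProbabilityMeasure_map hT
  rcases le_total a b with hab | hab
  · rw [← measureReal_map_Ioc P hT hab]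
    exact (measureReal_mono h).trans (measureReal_union_le _ _)
  · have : (P.map T).real (Iic b) ≤ (P.map T).real (Iic a) :=
      measureReal_mono (Iic_subset_Iic.2 hab)
    have : 0 ≤ P.real S + P.real B := by positivity
    linarith

/-- **For a fixed fractional exponent, the posterior median is an efficient centering.**
If `α ∈ (0,1]` is fixed, the `α`-posterior of `ψ(η)` satisfies a BvM theorem at rate
`√(n α)` around `ψ̂ₙ`, and `√n (ψ̂ₙ − ψ(η₀))` is asymptotically `N(0,V)`, then the posterior
median `ψ̄ₙ = a_{n,1/2}` satisfies `√n (ψ̄ₙ − ψ̂ₙ) → 0` in `P₀`-probability, and for every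
`δ ∈ (0,1)` the shift-and-rescale set centered at the median has asymptotic coverage
`1 − δ`. -/
theorem posterior_median_efficient_centering_fixed_alpha
    (Ω : ℕ → Type*) [∀ n, MeasurableSpace (Ω n)]
    (P : ∀ n, Measure (Ω n)) (hP : ∀ n, IsProbabilityMeasure (P n))
    (μpost : ∀ n, Ω n → Measure ℝ) (hμprob : ∀ n ω, IsProbabilityMeasure (μpost n ω))
    (ψhat : ∀ n, Ω n → ℝ) (ψ₀ : ℝ)
    (α : ℝ) (hα : α ∈ Set.Ioc (0 : ℝ) 1)
    (V : ℝ) (hV : 0 < V)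
    -- (i) BvM: pushforward of `μpost` under `x ↦ √(n α)(x − ψ̂ₙ)` converges weakly in
    -- `P₀`-probability to `N(0, V)`
    (hBvM : ∀ ε > (0 : ℝ),
      Tendsto (fun n => P n {ω |
        ε < dBL
          (Measure.map (fun x => Real.sqrt ((n : ℝ) * α) * (x - ψhat n ω)) (μpost n ω))
          (gaussianReal 0 (Real.toNNReal V))})
        atTop (nhds 0))
    -- (ii) `√n (ψ̂ₙ − ψ(η₀))` converges in distribution to `N(0, V)`
    (hCLT : Tendsto (fun n : ℕ =>
        dBL (Measure.map (fun ω => Real.sqrt n * (ψhat n ω - ψ₀)) (P n))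
          (gaussianReal 0 (Real.toNNReal V)))
      atTop (nhds 0)) :
    -- conclusion: the posterior median is an efficient centering, and the
    -- shift-and-rescale sets centered at it have asymptotic coverage `1 − δ`
    (∀ ε > (0 : ℝ),
      Tendsto (fun n : ℕ => P n {ω |
          ε < |Real.sqrt n * (quantile (μpost n ω) (1 / 2) - ψhat n ω)|})
        atTop (nhds 0)) ∧
    ∀ δ ∈ Set.Ioo (0 : ℝ) 1,
      Tendsto (fun n : ℕ => (P n {ω | ψ₀ ∈ Set.Ioc
          (Real.sqrt α * (quantile (μpost n ω) (δ / 2) - quantile (μpost n ω) (1 / 2))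
            + quantile (μpost n ω) (1 / 2))
          (Real.sqrt α * (quantile (μpost n ω) (1 - δ / 2) - quantile (μpost n ω) (1 / 2))
            + quantile (μpost n ω) (1 / 2))}).toReal)
        atTop (nhds (1 - δ)) := by
  set γ := gaussianReal 0 (Real.toNNReal V) with hγ
  have hv : Real.toNNReal V ≠ 0 := (Real.toNNReal_pos.2 hV).ne'
  have hna : NullSingletonClass γ := nullSingletonClass_gaussianReal hv
  have hmono : StrictMono fun x => γ.real (Iic x) := strictMono_gaussianReal_Iic 0 hv
  have hcont : Continuous fun x => γ.real (Iic x) := continuous_measureReal_Iic γ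
  have hneg : ∀ x, γ.real (Iic (-x)) = 1 - γ.real (Iic x) := gaussianReal_Iic_neg hv
  have hhalf : γ.real (Iic 0) = 1 / 2 := by
    have := hneg 0
    rw [neg_zero] at this
    linarith
  have hs : 0 < √α := Real.sqrt_pos.2 hα.1
  have hs1 : √α ≤ 1 := Real.sqrt_le_one.2 hα.2
  have hsqrt : ∀ n : ℕ, √((n : ℝ) * α) = √(n : ℝ) * √α := fun n =>
    Real.sqrt_mul (Nat.cast_nonneg n) α
  have hnpos : ∀ n : ℕ, 1 ≤ n → 0 < √(n : ℝ) := fun n hn =>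
    Real.sqrt_pos.2 (by exact_mod_cast hn)
  refine ⟨fun ε hε => ?_, fun δ hδ => ?_⟩
  · obtain ⟨η, hη, H⟩ := exists_dBL_imp_abs_quantile_sub_le γ hmono 0 (mul_pos hs hε)
    refine tendsto_of_tendsto_of_tendsto_of_le_of_le' tendsto_const_nhds (hBvM η hη)
      (Eventually.of_forall fun _ => zero_le) ?_
    filter_upwards [eventually_ge_atTop 1] with n hn
    refine measure_mono fun ω hω => ?_
    by_contra hle
    have hq := H (μpost n ω) (ψhat n ω) _ (hμprob n ω)
      (by rw [hsqrt]; exact mul_pos (hnpos n hn) hs) (not_lt.1 hle)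
    rw [hhalf, sub_zero, hsqrt, mul_comm √(n : ℝ), mul_assoc, abs_mul, abs_of_pos hs] at hq
    exact absurd (le_of_mul_le_mul_left hq hs) (not_le.2 hω)
  · obtain ⟨z, hz⟩ := exists_measureReal_Iic_eq γ (p := 1 - δ / 2)
      ⟨by linarith [hδ.2], by linarith [hδ.1]⟩
    have hnz : γ.real (Iic (-z)) = δ / 2 := by rw [hneg, hz]; ring
    have hzpos : 0 < z := hmono.lt_iff_lt.1 (by simp only [hhalf, hz]; linarith [hδ.2])
    refine Metric.tendsto_nhds.2 fun e he => ?_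
    have hout : Tendsto (fun t => γ.real (Iic (z + t)) - γ.real (Iic (-z - 2 * t)))
        (nhdsWithin 0 (Ioi 0)) (nhds (1 - δ)) := by
      have hc : Continuous fun t => γ.real (Iic (z + t)) - γ.real (Iic (-z - 2 * t)) :=
        (hcont.comp (by fun_prop : Continuous fun t : ℝ => z + t)).sub
          (hcont.comp (by fun_prop : Continuous fun t : ℝ => -z - 2 * t))
      refine (hc.tendsto' 0 _ ?_).mono_left nhdsWithin_le_nhds
      rw [add_zero, mul_zero, sub_zero, hz, hnz]; ring
    have hin : Tendsto (fun t => γ.real (Iic (z - 2 * t)) - γ.real (Iic (-z + t)))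
        (nhdsWithin 0 (Ioi 0)) (nhds (1 - δ)) := by
      have hc : Continuous fun t => γ.real (Iic (z - 2 * t)) - γ.real (Iic (-z + t)) :=
        (hcont.comp (by fun_prop : Continuous fun t : ℝ => z - 2 * t)).sub
          (hcont.comp (by fun_prop : Continuous fun t : ℝ => -z + t))
      refine (hc.tendsto' 0 _ ?_).mono_left nhdsWithin_le_nhds
      rw [add_zero, mul_zero, sub_zero, hz, hnz]; ring
    obtain ⟨ε, ⟨hεout, hεin⟩, hε⟩ :=
      (((hout.eventually_lt_const (show 1 - δ < 1 - δ + e / 3 by linarith)).and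
        (hin.eventually_const_lt (show 1 - δ - e / 3 < 1 - δ by linarith))).and
        self_mem_nhdsWithin).exists
    have hκ : 0 < √α * (ε / 2) := by positivity
    obtain ⟨η₁, hη₁, H₁⟩ := exists_dBL_imp_abs_quantile_sub_le γ hmono 0 hκ
    obtain ⟨η₂, hη₂, H₂⟩ := exists_dBL_imp_abs_quantile_sub_le γ hmono (-z) (half_pos hε)
    obtain ⟨η₃, hη₃, H₃⟩ := exists_dBL_imp_abs_quantile_sub_le γ hmono z (half_pos hε)
    have hclose : ∀ x, ∀ᶠ n in atTop,
        |((P n).map fun ω => √(n : ℝ) * (ψhat n ω - ψ₀)).real (Iic x) - γ.real (Iic x)|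
          < e / 6 ∧ AEMeasurable (fun ω => √(n : ℝ) * (ψhat n ω - ψ₀)) (P n) := by
      intro x
      obtain ⟨η, hη, H⟩ := exists_dBL_imp_abs_Iic_sub_lt γ hcont x (e := e / 6) (by linarith)
      filter_upwards [hCLT.eventually_lt_const hη, hCLT.eventually_lt_const one_pos] with n h1 h2
      have hae : AEMeasurable (fun ω => √(n : ℝ) * (ψhat n ω - ψ₀)) (P n) := by
        by_contra hna
        rw [Measure.map_of_not_aemeasurable hna] at h2
        exact absurd h2 (not_lt.2 (one_le_dBL_zero _))
      have := hP n
      exact ⟨H _ (Measure.isProbabilityMeasure_map hae) h1.le, hae⟩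
    have hB : Tendsto (fun n => (P n).real {ω | min η₁ (min η₂ η₃) < dBL
          ((μpost n ω).map fun x => √((n : ℝ) * α) * (x - ψhat n ω)) γ}) atTop (nhds 0) :=
      (ENNReal.tendsto_toReal_zero_iff (fun n => by have := hP n; exact measure_ne_top _ _)).2
        (hBvM _ (lt_min hη₁ (lt_min hη₂ hη₃)))
    filter_upwards [hclose (z + ε), hclose (-z - 2 * ε), hclose (z - 2 * ε), hclose (-z + ε),
      hB.eventually_lt_const (show 0 < e / 3 by linarith), eventually_ge_atTop 1]
      with n ⟨k₁, hT⟩ ⟨k₂, _⟩ ⟨k₃, _⟩ ⟨k₄, _⟩ hBn hn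
    have := hP n
    have hr := hnpos n hn
    have hc : 0 < √((n : ℝ) * α) := by rw [hsqrt]; exact mul_pos hr hs
    rw [abs_lt] at k₁ k₂ k₃ k₄
    rw [Real.dist_eq, abs_lt]
    set B := {ω | min η₁ (min η₂ η₃) < dBL
        ((μpost n ω).map fun x => √((n : ℝ) * α) * (x - ψhat n ω)) γ}
    set S := {ω | ψ₀ ∈ Set.Ioc
          (√α * (quantile (μpost n ω) (δ / 2) - quantile (μpost n ω) (1 / 2))
            + quantile (μpost n ω) (1 / 2))
          (√α * (quantile (μpost n ω) (1 - δ / 2) - quantile (μpost n ω) (1 / 2))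
            + quantile (μpost n ω) (1 / 2))}
    have key : ∀ ω, ω ∉ B →
        ∃ l u, |l + z| ≤ ε ∧ |u - z| ≤ ε ∧ (ω ∈ S ↔
          √(n : ℝ) * (ψhat n ω - ψ₀) < -l ∧ -u ≤ √(n : ℝ) * (ψhat n ω - ψ₀)) := by
      intro ω hω
      have hd := le_min_iff.1 (not_lt.1 (notMem_ofPred_iff.1 hω))
      have hd' := le_min_iff.1 hd.2
      have q₁ := H₁ (μpost n ω) (ψhat n ω) _ (hμprob n ω) hc hd.1
      have q₂ := H₂ (μpost n ω) (ψhat n ω) _ (hμprob n ω) hc hd'.1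
      have q₃ := H₃ (μpost n ω) (ψhat n ω) _ (hμprob n ω) hc hd'.2
      rw [hhalf, sub_zero, hsqrt, mul_comm √(n : ℝ), mul_assoc, abs_mul, abs_of_pos hs] at q₁
      rw [hnz, hsqrt, sub_neg_eq_add] at q₂
      rw [hz, hsqrt] at q₃
      have hM := le_of_mul_le_mul_left q₁ hs
      set M := (1 - √α) * (√(n : ℝ) * (quantile (μpost n ω) (1 / 2) - ψhat n ω)) with hMdef
      have hN : |M| ≤ ε / 2 := by
        rw [hMdef, abs_mul, abs_of_nonneg (sub_nonneg.2 hs1)]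
        exact (mul_le_of_le_one_left (abs_nonneg _) (by linarith)).trans hM
      rw [abs_le] at hN q₂ q₃
      refine ⟨√(n : ℝ) * √α * (quantile (μpost n ω) (δ / 2) - ψhat n ω) + M,
        √(n : ℝ) * √α * (quantile (μpost n ω) (1 - δ / 2) - ψhat n ω) + M,
        abs_le.2 ⟨by linarith, by linarith⟩, abs_le.2 ⟨by linarith, by linarith⟩, ?_⟩
      rw [mem_ofPred_eq, mem_Ioc, ← mul_lt_mul_iff_right₀ hr, ← mul_le_mul_iff_right₀ hr]
      refine and_congr ⟨fun h => ?_, fun h => ?_⟩ ⟨fun h => ?_, fun h => ?_⟩ <;>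
        rw [hMdef] at * <;> linarith
    have up := measureReal_le_map_Iic_sub_add (P n) hT
      (show -z - 2 * ε ≤ z + ε by linarith) (S := S) (B := B) (by
        intro ω hω
        by_contra hcon
        rw [mem_union, not_or] at hcon
        obtain ⟨l, u, hl, hu, hiff⟩ := key ω hcon.2
        rw [abs_le] at hl hu
        obtain ⟨t1, t2⟩ := hiff.1 hω
        exact hcon.1 ⟨by linarith, by linarith⟩)
    have low := map_Iic_sub_le_measureReal_add (P n) hT (a := -z + ε) (b := z - 2 * ε)
      (S := S) (B := B) (by
        intro ω hω
        by_contra hcon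
        rw [mem_union, not_or] at hcon
        obtain ⟨l, u, hl, hu, hiff⟩ := key ω hcon.2
        rw [abs_le] at hl hu
        obtain ⟨t1, t2⟩ := hω
        exact hcon.1 (hiff.2 ⟨by linarith, by linarith⟩))
    rw [← measureReal_def]
    constructor <;> linarith [k₁.1, k₁.2, k₂.1, k₂.2, k₃.1, k₃.2, k₄.1, k₄.2]
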